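/- arXiv:2506.21268 — 3 statements merged into one kernel-verified Lean document; each statement's English description precedes it below -/
import Mathlib

section
/- Let D be a v-reduced divisor on a metric graph Γ and f ∈ R(D). Then for every a ≤ f(v), the superlevel set f^{-1}([a,∞)) is connected. -/
open scoped ENNReal
open Set Function

namespace TropGraph

variable {G : Type*} [MetricSpace G]

/-! ### Metric graphs: length spaces with star-shaped neighbourhoods -/

/-- The length of a path, via the extended variation of its extension to `ℝ`. -/
noncomputable def pathLength {x y : G} (g : Path x y) : ℝ≥0∞ :=
  eVariationOn (fun t : ℝ => g.extend t) (Set.Icc 0 1)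

/-- The star with `v` branches of radius `ε`: a disjoint union of `v` copies of `[0, ε)`
with all the zeroes identified. -/
def starSetoid (v : ℕ) (ε : ℝ) : Setoid (Fin v × Set.Ico (0:ℝ) ε) where
  r a b := a = b ∨ ((a.2 : ℝ) = 0 ∧ (b.2 : ℝ) = 0)
  iseqv :=
    { refl := fun _ => Or.inl rfl
      symm := fun h => h.imp Eq.symm And.symm
      trans := fun h₁ h₂ => by
        rcases h₁ with rfl | h₁
        · exact h₂
        · rcases h₂ with rfl | h₂
          · exact Or.inr h₁
          · exact Or.inr ⟨h₁.1, h₂.2⟩ }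

/-- The glued star-shaped space `⊔_{i=1}^v [0, ε) / ∼`. -/
def StarGlue (v : ℕ) (ε : ℝ) : Type :=
  Quotient (starSetoid v ε)

instance (v : ℕ) (ε : ℝ) : TopologicalSpace (StarGlue v ε) := by
  unfold StarGlue; infer_instance

/-- `U` is a star-shaped neighbourhood of `x` of valence `v`. -/
def IsStarNbhdOf (x : G) (v : ℕ) (U : Set G) : Prop :=
  ∃ (ε : ℝ) (hε : 0 < ε) (φ : U ≃ₜ StarGlue v ε) (hx : x ∈ U),
    ∀ i : Fin v, φ ⟨x, hx⟩ = Quotient.mk (starSetoid v ε) (i, ⟨0, le_rfl, hε⟩)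

/-- A metric graph: a compact length space in which every point has a star-shaped
neighbourhood. -/
def IsMetricGraph (X : Type*) [MetricSpace X] : Prop :=
  CompactSpace X ∧
  (∀ x y : X, edist x y = ⨅ g : Path x y, pathLength g) ∧
  ∀ x : X, ∃ (v : ℕ) (U : Set X), U ∈ nhds x ∧ IsStarNbhdOf x v U

/-- `x` has valence `v`. -/
def HasValence (x : G) (v : ℕ) : Prop :=
  ∃ U ∈ nhds x, IsStarNbhdOf x v U

/-! ### Rational functions, tangent directions, orders and divisors -/

/-- `g` is a unit speed (isometric) path of length `ε` starting at `x`. -/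
def IsUnitSpeedFrom (x : G) (ε : ℝ) (g : ℝ → G) : Prop :=
  g 0 = x ∧ ∀ s ∈ Set.Ico (0:ℝ) ε, ∀ t ∈ Set.Ico (0:ℝ) ε, dist (g s) (g t) = |s - t|

/-- `f` has (integer) slope `s` along the path `g` near its starting point. -/
def HasSlopeAlong (f : G → ℝ) (g : ℝ → G) (s : ℤ) : Prop :=
  ∃ δ > (0:ℝ), ∀ t ∈ Set.Ico (0:ℝ) δ, f (g t) = f (g 0) + s * t

/-- A rational function: continuous, and linear with integer slope along every direction
near every point.  (On a compact metric graph this coincides with being continuous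
piecewise linear with integer slopes.) -/
def IsRational (f : G → ℝ) : Prop :=
  Continuous f ∧ ∀ (x : G) (ε : ℝ) (g : ℝ → G), 0 < ε → IsUnitSpeedFrom x ε g →
    ∃ s : ℤ, HasSlopeAlong f g s

/-- Unit speed paths emanating from `x`. -/
def UnitPath (x : G) : Type _ :=
  {g : ℝ → G // ∃ ε > (0:ℝ), IsUnitSpeedFrom x ε g}

/-- Two unit speed paths are equivalent when they agree near `0`. -/
def germSetoid (x : G) : Setoid (UnitPath x) where
  r g₁ g₂ := ∃ δ > (0:ℝ), ∀ t ∈ Set.Ico (0:ℝ) δ, g₁.1 t = g₂.1 t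
  iseqv := by
    constructor
    · intro g
      obtain ⟨ε, hε, _⟩ := g.2
      exact ⟨ε, hε, fun t _ => rfl⟩
    · rintro g₁ g₂ ⟨δ, hδ, h⟩
      exact ⟨δ, hδ, fun t ht => (h t ht).symm⟩
    · rintro g₁ g₂ g₃ ⟨δ₁, hδ₁, h₁⟩ ⟨δ₂, hδ₂, h₂⟩
      refine ⟨min δ₁ δ₂, lt_min hδ₁ hδ₂, fun t ht => ?_⟩
      have ht' := Set.mem_Ico.mp ht
      rw [h₁ t (Set.mem_Ico.mpr ⟨ht'.1, lt_of_lt_of_le ht'.2 (min_le_left _ _)⟩),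
        h₂ t (Set.mem_Ico.mpr ⟨ht'.1, lt_of_lt_of_le ht'.2 (min_le_right _ _)⟩)]

/-- The set of (unit) tangent directions at `x`: germs of unit speed paths from `x`. -/
def TangentDir (x : G) : Type _ :=
  Quotient (germSetoid x)

open scoped Classical in
/-- The outgoing slope of `f` along a tangent direction. -/
noncomputable def tangentSlope (f : G → ℝ) {x : G} (ζ : TangentDir x) : ℤ :=
  if h : ∃ s : ℤ, HasSlopeAlong f (Quotient.out ζ).1 s then h.choose else 0

/-- The order of `f` at `x`: the sum of the outgoing slopes of `f` at `x`. -/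
noncomputable def ordAt (f : G → ℝ) (x : G) : ℤ :=
  ∑ᶠ ζ : TangentDir x, tangentSlope f ζ

/-- Divisors are represented as finitely supported functions `G → ℤ`. -/
def FinSupp (D : G → ℤ) : Prop :=
  (Function.support D).Finite

/-- A divisor is effective when all its coefficients are nonnegative. -/
def Effective (D : G → ℤ) : Prop :=
  ∀ x, 0 ≤ D x

/-- The degree of a divisor. -/
noncomputable def deg (D : G → ℤ) : ℤ :=
  ∑ᶠ x, D x

/-- The degree of the restriction of a divisor to a subset. -/
noncomputable def degOn (S : Set G) (D : G → ℤ) : ℤ :=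
  ∑ᶠ x ∈ S, D x

/-- Linear equivalence of divisors: the difference is the divisor of a rational function. -/
def LinEquiv (D D' : G → ℤ) : Prop :=
  ∃ f : G → ℝ, IsRational f ∧ ∀ x, D' x = D x + ordAt f x

/-- `R(D)`: rational functions `f` with `D + div f ≥ 0`. -/
def RD (D : G → ℤ) : Set (G → ℝ) :=
  {f | IsRational f ∧ ∀ x, 0 ≤ D x + ordAt f x}

/-- The complete linear system `|D₀|` of effective divisors linearly equivalent to `D₀`. -/
def LinSys (D₀ : G → ℤ) : Set (G → ℤ) :=
  {D | FinSupp D ∧ Effective D ∧ LinEquiv D₀ D}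

/-- The oscillation `max f - min f` of a function. -/
noncomputable def osc (f : G → ℝ) : ℝ :=
  sSup (Set.range f) - sInf (Set.range f)

/-- The distance `d_∞` on a complete linear system. -/
noncomputable def linDist (D₁ D₂ : G → ℤ) : ℝ :=
  sInf {r : ℝ | ∃ f : G → ℝ, IsRational f ∧ (∀ x, D₂ x = D₁ x + ordAt f x) ∧ r = osc f}

/-- `f` is constant on `S`. -/
def ConstOn (f : G → ℝ) (S : Set G) : Prop :=
  ∀ x ∈ S, ∀ y ∈ S, f x = f y

/-! ### Subgraphs, arcs, components, firing -/

/-- An open arc: the isometric image of a nonempty open interval. -/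
def IsOpenArc (S : Set G) : Prop :=
  ∃ (a b : ℝ) (g : ℝ → G), a < b ∧
    (∀ s ∈ Set.Ioo a b, ∀ t ∈ Set.Ioo a b, dist (g s) (g t) = |s - t|) ∧
    S = g '' Set.Ioo a b

/-- The set of connected components of a subset. -/
def compsOf (S : Set G) : Set (Set G) :=
  {C | ∃ x ∈ S, C = connectedComponentIn S x}

/-- The outgoing degree of `x` with respect to a closed subgraph `Z`:
the number of tangent directions at `x` leaving `Z`. -/
noncomputable def degOut (Z : Set G) (x : G) : ℕ :=
  Nat.card {ζ : TangentDir x //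
    ∃ δ > (0:ℝ), ∀ t ∈ Set.Ioo (0:ℝ) δ, (Quotient.out ζ).1 t ∉ interior Z}

/-- A closed subgraph `Z` can fire with respect to `D` when `D(x) ≥ deg^out_Z(x)` for
all `x` on the boundary of `Z`. -/
def CanFire (D : G → ℤ) (Z : Set G) : Prop :=
  Z.Nonempty ∧ IsClosed Z ∧ (compsOf Z).Finite ∧
  ∀ x ∈ frontier Z, (degOut Z x : ℤ) ≤ D x

/-- A `v`-reduced divisor. -/
def IsReduced (v : G) (D : G → ℤ) : Prop :=
  (∀ x, x ≠ v → 0 ≤ D x) ∧ ∀ Z : Set G, v ∉ Z → ¬CanFire D Z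

/-- `D` is `V`-unsaturated: no closed subgraph whose boundary meets `V` can fire. -/
def Unsaturated (V : Set G) (D : G → ℤ) : Prop :=
  ¬∃ Z : Set G, (frontier Z ∩ V).Nonempty ∧ CanFire D Z

/-- A local maximum of `f`: a closed connected set on which `f` is constant, with a
neighbourhood on which `f` is strictly smaller outside of it. -/
def IsLocalMaxSet (f : G → ℝ) (C : Set G) : Prop :=
  IsClosed C ∧ IsConnected C ∧ ConstOn f C ∧
  ∃ U, IsOpen U ∧ C ⊆ U ∧ ∀ x ∈ U \ C, ∀ y ∈ C, f x < f y

/-! ### Models and genus -/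

/-- A model of the metric graph: a finite set of vertices whose complement is a finite
disjoint union of open arcs. -/
def IsGraphModel (V : Set G) : Prop :=
  V.Finite ∧ (compsOf Vᶜ).Finite ∧ ∀ C ∈ compsOf Vᶜ, IsOpenArc C

/-- A model has no self-loops: the closure of each open edge contains two distinct
endpoints. -/
def LoopFree (V : Set G) : Prop :=
  ∀ C ∈ compsOf Vᶜ, (closure C \ C).ncard = 2

/-- A model of an open subgraph `U`, together with valences of its vertices inside `U`. -/
def IsModelIn (U V : Set G) (val : G → ℕ) : Prop :=
  V ⊆ U ∧ V.Finite ∧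
  (∀ x ∈ V, ∃ W ∈ nhds x, W ⊆ U ∧ IsStarNbhdOf x (val x) W) ∧
  (compsOf (U \ V)).Finite ∧ (∀ C ∈ compsOf (U \ V), IsOpenArc C) ∧
  (compsOf U).Finite

/-- The genus (first Betti number) of an open subgraph `U`, i.e. of its completion:
computed from any model as `Σ val(x) - #edges - #vertices + #components`. -/
def HasGenusOpen (U : Set G) (g : ℤ) : Prop :=
  ∃ (V : Set G) (val : G → ℕ), IsModelIn U V val ∧
    g = (∑ᶠ x ∈ V, (val x : ℤ)) - ((compsOf (U \ V)).ncard : ℤ)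
        - (V.ncard : ℤ) + ((compsOf U).ncard : ℤ)

/-! ### Chip firing moves -/

/-- The open `ε`-neighbourhood of `Z`. -/
def ZNbhd (Z : Set G) (ε : ℝ) : Set G :=
  {x | Metric.infDist x Z < ε}

/-- The chip firing function `CF(Z, ε)`. -/
noncomputable def CF (Z : Set G) (ε : ℝ) : G → ℝ :=
  fun x => -min (Metric.infDist x Z) ε

/-- The data of a chip firing move: a closed subgraph with finitely many components such
that `Z_ε \ Z` is a disjoint union of open intervals. -/
def ChipData (Z : Set G) (ε : ℝ) : Prop :=
  IsClosed Z ∧ Z.Nonempty ∧ (compsOf Z).Finite ∧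
  ∀ C ∈ compsOf (ZNbhd Z ε \ Z), IsOpenArc C

/-- `h` is a chip firing move. -/
def IsCFMove (h : G → ℝ) : Prop :=
  ∃ (Z : Set G) (ε : ℝ), 0 < ε ∧ ChipData Z ε ∧ h = CF Z ε

/-- `f` is linear (with some real slope) on the open arc `C`. -/
def LinearOnArc (f : G → ℝ) (C : Set G) : Prop :=
  ∃ (a b : ℝ) (g : ℝ → G) (s c : ℝ), a < b ∧
    (∀ u ∈ Set.Ioo a b, ∀ t ∈ Set.Ioo a b, dist (g u) (g t) = |u - t|) ∧
    C = g '' Set.Ioo a b ∧ ∀ t ∈ Set.Ioo a b, f (g t) = s * t + c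

/-- A weighted chip firing move. -/
def IsWeightedCF (f : G → ℝ) : Prop :=
  IsRational f ∧ (¬∀ x y : G, f x = f y) ∧
  ∃ Z₁ Z₂ : Set G, IsClosed Z₁ ∧ IsClosed Z₂ ∧ Z₁.Nonempty ∧ Z₂.Nonempty ∧
    Disjoint Z₁ Z₂ ∧ Z₁ ≠ Set.univ ∧ Z₂ ≠ Set.univ ∧
    (∀ C ∈ compsOf (Z₁ ∪ Z₂)ᶜ, IsOpenArc C) ∧
    ConstOn f Z₁ ∧ ConstOn f Z₂ ∧
    ∀ C ∈ compsOf (Z₁ ∪ Z₂)ᶜ, LinearOnArc f C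

/-! ### Cells of the complete linear system -/

/-- The part of the support of a divisor lying in the interiors of the edges. -/
def edgeSupp (V : Set G) (D : G → ℤ) : Set G :=
  {x | x ∉ V ∧ D x ≠ 0}

/-- The dimension of the cell of `|D₀|` containing `D` in its relative interior:
the number of connected components of `Γ ∖ supp D_E`, minus one. -/
noncomputable def cellDim (V : Set G) (D : G → ℤ) : ℤ :=
  ((compsOf (edgeSupp V D)ᶜ).ncard : ℤ) - 1

/-- Two divisors of `|D₀|` have the same combinatorial type with respect to the model `V`
(they lie in the relative interior of the same cell): equal multiplicities on the
vertices, chip configurations on the edges related by a homeomorphism fixing the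
vertices and each edge, and equal slopes at all tangent directions at the vertices. -/
def SameType (V : Set G) (D₀ D₁ D₂ : G → ℤ) : Prop :=
  (∀ v ∈ V, D₁ v = D₂ v) ∧
  (∃ h : G ≃ₜ G, (∀ v ∈ V, h v = v) ∧ (∀ x ∉ V, h x ∈ connectedComponentIn Vᶜ x) ∧
    ∀ x, D₂ (h x) = D₁ x) ∧
  (∃ f₁ f₂ : G → ℝ, IsRational f₁ ∧ IsRational f₂ ∧
    (∀ x, D₁ x = D₀ x + ordAt f₁ x) ∧ (∀ x, D₂ x = D₀ x + ordAt f₂ x) ∧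
    ∀ v ∈ V, ∀ ζ : TangentDir v, tangentSlope f₁ ζ = tangentSlope f₂ ζ)

/-- `D'` lies in the closed cell `Δ_D` of `|D₀|`. -/
def InClosedCell (V : Set G) (D₀ D D' : G → ℤ) : Prop :=
  ∀ ε > (0:ℝ), ∃ D'' : G → ℤ, SameType V D₀ D D'' ∧ linDist D' D'' < ε

/-- `D` is generic in `|D₀|`: it lies in the relative interior of an inclusion-wise
maximal cell, i.e. all sufficiently nearby divisors of `|D₀|` lie in the closed cell
of `D`. -/
def Generic (V : Set G) (D₀ D : G → ℤ) : Prop :=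
  D ∈ LinSys D₀ ∧ ∃ ε > (0:ℝ), ∀ D' ∈ LinSys D₀, linDist D D' < ε → InClosedCell V D₀ D D'

/-- The rank of `D` is at least `d`: for every effective divisor `E` of degree `d`,
`|D - E|` is nonempty. -/
def rankGe (D : G → ℤ) (d : ℕ) : Prop :=
  ∀ E : G → ℤ, FinSupp E → Effective E → deg E = (d : ℤ) →
    ∃ D' : G → ℤ, FinSupp D' ∧ Effective D' ∧ LinEquiv (fun x => D x - E x) D'

/-! ### Cycles, the canonical divisor and realizability -/

/-- A simple cycle: a subset homeomorphic to a circle. -/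
def IsCycleSet (C : Set G) : Prop :=
  Nonempty (C ≃ₜ AddCircle (1 : ℝ))

/-- The canonical divisor `K + div f` for a vertex valence function `val`. -/
noncomputable def canDiv (val : G → ℕ) (f : G → ℝ) : G → ℤ :=
  fun x => (val x : ℤ) - 2 + ordAt f x

/-- The enhanced-level-graph invariant `k(ζ) = -s_ζ(f) - 1` of a tangent direction. -/
noncomputable def kVal (f : G → ℝ) {v : G} (ζ : TangentDir v) : ℤ :=
  -(tangentSlope f ζ) - 1

/-- `v` is an inconvenient vertex of the enhanced level graph `Γ⁺(f)` (all vertex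
weights `h ≡ 0`): no `k`-value equals `-1`, and some `k`-value (of a half-edge, or of
one of the `D(v)` attached legs, which carry `k = 1`) exceeds
`Σ_{k_j < 0} (-k_j) - #{k_j < 0} - 1`.  (Legs have `k = 1 > 0` and so never contribute
to the sums, and their `k`-value is `≠ -1`.) -/
def Inconvenient (val : G → ℕ) (f : G → ℝ) (v : G) : Prop :=
  (∀ ζ : TangentDir v, kVal f ζ ≠ -1) ∧
  ∃ k₀ : ℤ, ((∃ ζ : TangentDir v, kVal f ζ = k₀) ∨ (0 < canDiv val f v ∧ k₀ = 1)) ∧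
    (∑ᶠ ζ ∈ {ζ : TangentDir v | kVal f ζ < 0}, (-kVal f ζ))
      - (({ζ : TangentDir v | kVal f ζ < 0}).ncard : ℤ) - 1 < k₀

/-- The realizability criterion of Möller–Ulirsch–Werner for the effective canonical
divisor `K + div f`: every inconvenient vertex, and every open arc on which `f` is
constant, away from the bends of `f` and from higher-valence points, is contained in a
simple cycle lying above it. -/
def RealizableFn (val : G → ℕ) (f : G → ℝ) : Prop :=
  (∀ v, Inconvenient val f v →
    ∃ Z : Set G, IsCycleSet Z ∧ v ∈ Z ∧ ∀ z ∈ Z, f v ≤ f z) ∧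
  (∀ A : Set G, IsOpenArc A → ConstOn f A → (∀ x ∈ A, ordAt f x = 0 ∧ val x = 2) →
    ∃ Z : Set G, IsCycleSet Z ∧ A ⊆ Z ∧ ∀ z ∈ Z, ∀ a ∈ A, f a ≤ f z)

/-- The realizability locus inside the canonical linear system. -/
def RealSet (val : G → ℕ) : Set (G → ℤ) :=
  {D | ∃ f : G → ℝ, IsRational f ∧ (∀ x, D x = (val x : ℤ) - 2 + ordAt f x) ∧
    RealizableFn val f}

/-! ### Tropical linear series -/

/-- The cone `R(𝔡, D)` of rational functions `f` with `D + div f ∈ 𝔡`. -/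
def coneOf (D : G → ℤ) (𝔡 : Set (G → ℤ)) : Set (G → ℝ) :=
  {f | IsRational f ∧ (fun x => D x + ordAt f x) ∈ 𝔡}

/-- A tropical linear series: a tropically convex subset of a complete linear system,
i.e. one whose cone of rational functions is a tropical submodule. -/
def TropLinearSeries (D₀ : G → ℤ) (𝔡 : Set (G → ℤ)) : Prop :=
  𝔡 ⊆ LinSys D₀ ∧
  (∀ f ∈ coneOf D₀ 𝔡, ∀ g ∈ coneOf D₀ 𝔡, (fun x => max (f x) (g x)) ∈ coneOf D₀ 𝔡) ∧
  (∀ c : ℝ, ∀ f ∈ coneOf D₀ 𝔡, (fun x => c + f x) ∈ coneOf D₀ 𝔡)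

/-- The rank of the tropical linear series `𝔡` is at least `d`:
`𝔡(-E)` is nonempty for every effective divisor `E` of degree `d`. -/
def lsRankGe (𝔡 : Set (G → ℤ)) (d : ℕ) : Prop :=
  ∀ E : G → ℤ, FinSupp E → Effective E → deg E = (d : ℤ) →
    ∃ D ∈ 𝔡, ∀ x, E x ≤ D x

/-- `D` splits in `𝔡`: some non-constant `f ∈ R(𝔡, D)`, with maximum locus `Z`, has a
boundary point `x ∈ ∂Z` with `D(x) + ord_x(f) > 0`. -/
def Splits (𝔡 : Set (G → ℤ)) (D : G → ℤ) : Prop :=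
  ∃ f ∈ coneOf D 𝔡, (¬∀ x y : G, f x = f y) ∧
    ∃ x ∈ frontier {y | ∀ z, f z ≤ f y}, 0 < D x + ordAt f x

/-- The pairing of a divisor with a test function. -/
noncomputable def pairing (D : G → ℤ) (φ : G → ℝ) : ℝ :=
  ∑ᶠ x, (D x : ℝ) * φ x

/-- The tangent space of `X` at `D` has dimension at least `r`: there are `r`
one-sided differentiable paths through `D` inside `X` whose derivatives (as linear
functionals on rational test functions) are linearly independent. -/
def TangentDimGe (X : Set (G → ℤ)) (D : G → ℤ) (r : ℕ) : Prop :=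
  ∃ (c : Fin r → ℝ → G → ℤ) (L : Fin r → (G → ℝ) → ℝ) (ε : ℝ), 0 < ε ∧
    (∀ i, c i 0 = D) ∧ (∀ i, ∀ t ∈ Set.Ico (0:ℝ) ε, c i t ∈ X) ∧
    (∀ i, ∀ φ : G → ℝ, IsRational φ →
      HasDerivWithinAt (fun t => pairing (c i t) φ) (L i φ) (Set.Ici 0) 0) ∧
    LinearIndependent ℝ L


/-! ### Branches of a star-shaped neighbourhood -/

/-- A point of the star with `n` branches determines its distance from the centre. -/
def starRadius (n : ℕ) (ε : ℝ) : StarGlue n ε → ℝ :=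
  Quotient.lift (fun p : Fin n × Set.Ico (0:ℝ) ε => (p.2 : ℝ)) (by
    rintro p q (rfl | ⟨hp, hq⟩)
    · rfl
    · exact hp.trans hq.symm)

/-- The `i`-th branch of the star, without the centre. -/
def starBranch (n : ℕ) (ε : ℝ) (i : Fin n) : Set (StarGlue n ε) :=
  {q | ∃ s : Set.Ico (0:ℝ) ε, 0 < (s : ℝ) ∧ q = Quotient.mk (starSetoid n ε) (i, s)}

lemma continuous_starRadius (n : ℕ) (ε : ℝ) : Continuous (starRadius n ε) :=
  Continuous.quotient_lift (s := starSetoid n ε) (by fun_prop) _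

lemma mk_mem_starBranch {n : ℕ} {ε : ℝ} {i : Fin n} {p : Fin n × Set.Ico (0:ℝ) ε} :
    Quotient.mk (starSetoid n ε) p ∈ starBranch n ε i ↔ p.1 = i ∧ 0 < (p.2 : ℝ) := by
  constructor
  · rintro ⟨s, hs, h⟩
    rcases Quotient.exact h with rfl | ⟨-, h0⟩
    · exact ⟨rfl, hs⟩
    · exact absurd h0 hs.ne'
  · rintro ⟨rfl, h⟩
    exact ⟨p.2, h, rfl⟩

lemma isOpen_starBranch (n : ℕ) (ε : ℝ) (i : Fin n) : IsOpen (starBranch n ε i) := by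
  have hq : Topology.IsQuotientMap (Quotient.mk (starSetoid n ε)) := isQuotientMap_quotient_mk'
  refine hq.isOpen_preimage.mp ?_
  have : Quotient.mk (starSetoid n ε) ⁻¹' starBranch n ε i =
      (fun p : Fin n × Set.Ico (0:ℝ) ε => p.1) ⁻¹' {i} ∩ {p | 0 < (p.2 : ℝ)} := by
    ext p
    exact mk_mem_starBranch
  rw [this]
  exact ((isOpen_discrete {i}).preimage continuous_fst).inter
    (isOpen_lt continuous_const (by fun_prop))

/-- The traces in `G` of the branches of a star-shaped neighbourhood: near `x`, the space
without `x` is covered by disjoint open branches `B i`, each embedded by a radius `ρ`. -/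
structure BranchCover (x : G) (n : ℕ) where
  /-- The open neighbourhood of `x` covered by the branches. -/
  W : Set G
  /-- The branches, without `x`. -/
  B : Fin n → Set G
  /-- The radius. -/
  ρ : G → ℝ
  isOpen_W : IsOpen W
  mem_W : x ∈ W
  isOpen_B : ∀ i, IsOpen (B i)
  disjoint_B : ∀ i j, i ≠ j → Disjoint (B i) (B j)
  cover : ∀ y ∈ W, y ≠ x → ∃ i, y ∈ B i
  continuousOn : ContinuousOn ρ W
  radius_center : ρ x = 0
  radius_pos : ∀ i, ∀ y ∈ B i, 0 < ρ y
  injOn : ∀ i, Set.InjOn ρ (B i)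

lemma IsStarNbhdOf.exists_branchCover {x : G} {n : ℕ} {U : Set G} (h : IsStarNbhdOf x n U)
    (hU : U ∈ nhds x) : Nonempty (BranchCover x n) := by
  classical
  obtain ⟨ε, hε, φ, hx, hφ⟩ := h
  have hρ : ∀ y (hy : y ∈ U), (if h : y ∈ U then starRadius n ε (φ ⟨y, h⟩) else 0) =
    starRadius n ε (φ ⟨y, hy⟩) := fun y hy => dif_pos hy
  refine ⟨{
    W := interior U
    B := fun i => interior U ∩ Subtype.val '' (φ ⁻¹' starBranch n ε i)
    ρ := fun y => if h : y ∈ U then starRadius n ε (φ ⟨y, h⟩) else 0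
    isOpen_W := isOpen_interior
    mem_W := mem_interior_iff_mem_nhds.mpr hU
    isOpen_B := fun i => ?_
    disjoint_B := fun i j hij => ?_
    cover := fun y hy hyx => ?_
    continuousOn := ?_
    radius_center := ?_
    radius_pos := ?_
    injOn := ?_ }⟩
  · obtain ⟨O, hO, hO'⟩ := isOpen_induced_iff.mp ((isOpen_starBranch n ε i).preimage φ.continuous)
    rw [← hO', Subtype.image_preimage_coe, ← inter_assoc, inter_eq_left.mpr interior_subset]
    exact isOpen_interior.inter hO
  · rw [Set.disjoint_left]
    rintro _ ⟨-, y, hy, rfl⟩ ⟨-, z, hz, hzy⟩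
    obtain rfl := Subtype.ext hzy
    obtain ⟨s, hs, h⟩ := hy
    rw [mem_preimage, h] at hz
    exact hij (mk_mem_starBranch.mp hz).1
  · have hyU := interior_subset hy
    obtain ⟨p, hp⟩ := Quotient.exists_rep (φ ⟨y, hyU⟩)
    refine ⟨p.1, hy, ⟨y, hyU⟩, ?_, rfl⟩
    rw [mem_preimage, ← hp]
    refine mk_mem_starBranch.mpr ⟨rfl, lt_of_le_of_ne p.2.2.1 fun h0 => hyx ?_⟩
    have : φ ⟨y, hyU⟩ = φ ⟨x, hx⟩ := by
      rw [← hp, hφ p.1]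
      exact Quotient.sound (Or.inr ⟨h0.symm, rfl⟩)
    exact congrArg Subtype.val (φ.injective this)
  · refine ContinuousOn.mono (s := U) ?_ interior_subset
    rw [continuousOn_iff_continuous_domRestrict]
    refine ((continuous_starRadius n ε).comp φ.continuous).congr fun y => ?_
    exact (hρ y.1 y.2).symm
  · obtain ⟨p, hp⟩ := Quotient.exists_rep (φ ⟨x, hx⟩)
    rw [hρ x hx, hφ p.1]
    rfl
  · rintro i _ ⟨-, y, ⟨s, hs, h⟩, rfl⟩
    rw [hρ y y.2]
    change 0 < starRadius n ε (φ y)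
    rw [h]
    exact hs
  · rintro i _ ⟨-, y, ⟨s, hs, h⟩, rfl⟩ _ ⟨-, z, ⟨t, ht, h'⟩, rfl⟩ hyz
    simp only [hρ y y.2, hρ z z.2] at hyz
    change starRadius n ε (φ y) = starRadius n ε (φ z) at hyz
    rw [h, h'] at hyz
    have hst : s = t := Subtype.ext hyz
    rw [← hst] at h'
    exact congrArg Subtype.val (φ.injective (h.trans h'.symm))

lemma IsUnitSpeedFrom.dist_eq {x : G} {ε : ℝ} {g : ℝ → G} (hg : IsUnitSpeedFrom x ε g) {t : ℝ}
    (ht : t ∈ Set.Ico 0 ε) : dist x (g t) = t := by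
  have := hg.2 0 ⟨le_rfl, ht.1.trans_lt ht.2⟩ t ht
  rwa [hg.1, zero_sub, abs_neg, abs_of_nonneg ht.1] at this

lemma IsUnitSpeedFrom.continuousOn {x : G} {ε : ℝ} {g : ℝ → G} (hg : IsUnitSpeedFrom x ε g) :
    ContinuousOn g (Set.Ico 0 ε) := by
  refine LipschitzOnWith.continuousOn (K := 1) (LipschitzOnWith.of_dist_le_mul ?_)
  intro s hs t ht
  rw [hg.2 s hs t ht, Real.dist_eq, NNReal.coe_one, one_mul]

lemma IsUnitSpeedFrom.exists_forall_mem {x : G} {ε : ℝ} {g : ℝ → G} (hε : 0 < ε)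
    (hg : IsUnitSpeedFrom x ε g) {N : Set G} (hN : N ∈ nhds x) :
    ∃ δ, 0 < δ ∧ δ ≤ ε ∧ ∀ t ∈ Set.Ico 0 δ, g t ∈ N := by
  obtain ⟨r, hr, hrN⟩ := Metric.mem_nhds_iff.mp hN
  refine ⟨min r ε, lt_min hr hε, min_le_right _ _, fun t ht => hrN ?_⟩
  rw [Metric.mem_ball, dist_comm, hg.dist_eq ⟨ht.1, ht.2.trans_le (min_le_right _ _)⟩]
  exact ht.2.trans_le (min_le_left _ _)

/-- A unit speed path from `x` starts inside a single branch. -/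
lemma BranchCover.exists_branch {x : G} {n : ℕ} (b : BranchCover x n) {ε : ℝ} {g : ℝ → G}
    (hε : 0 < ε) (hg : IsUnitSpeedFrom x ε g) :
    ∃ i, ∃ δ, 0 < δ ∧ δ ≤ ε ∧ (∀ t ∈ Set.Ico 0 δ, g t ∈ b.W) ∧ ∀ t ∈ Set.Ioo 0 δ, g t ∈ b.B i := by
  obtain ⟨δ, hδ, hδε, hW⟩ := hg.exists_forall_mem hε (b.isOpen_W.mem_nhds b.mem_W)
  have hcov : ∀ t ∈ Set.Ioo 0 δ, ∃ i, g t ∈ b.B i := fun t ht => by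
    refine b.cover _ (hW t ⟨ht.1.le, ht.2⟩) fun h => ?_
    have := hg.dist_eq ⟨ht.1.le, ht.2.trans_le hδε⟩
    rw [h, dist_self] at this
    exact ht.1.ne this
  have hmid : δ / 2 ∈ Set.Ioo 0 δ := ⟨by linarith, by linarith⟩
  obtain ⟨i, hi⟩ := hcov _ hmid
  refine ⟨i, δ, hδ, hδε, hW, fun t ht => ?_⟩
  have hpre : IsPreconnected (g '' Set.Ioo 0 δ) :=
    isPreconnected_Ioo.image _ (hg.continuousOn.mono fun s hs => ⟨hs.1.le, hs.2.trans_le hδε⟩)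
  refine hpre.subset_left_of_subset_union (b.isOpen_B i)
    (isOpen_biUnion (s := {j | j ≠ i}) fun j _ => b.isOpen_B j) ?_ ?_
    ⟨g (δ / 2), mem_image_of_mem g hmid, hi⟩ (mem_image_of_mem g ht)
  · exact Set.disjoint_iUnion₂_right.mpr fun j hj => b.disjoint_B i j (Ne.symm hj)
  · rintro _ ⟨s, hs, rfl⟩
    obtain ⟨j, hj⟩ := hcov s hs
    by_cases hji : j = i
    · exact Or.inl (hji ▸ hj)
    · exact Or.inr (Set.mem_biUnion (s := {j | j ≠ i}) hji hj)

/-- A unit speed path which starts inside a branch covers this branch near `x`. -/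
lemma BranchCover.exists_nhds_subset {x : G} {n : ℕ} (b : BranchCover x n) {ε : ℝ} {g : ℝ → G}
    (hg : IsUnitSpeedFrom x ε g) {i : Fin n} {δ : ℝ} (hδ : 0 < δ) (hδε : δ ≤ ε)
    (hW : ∀ t ∈ Set.Ico 0 δ, g t ∈ b.W) (hB : ∀ t ∈ Set.Ioo 0 δ, g t ∈ b.B i)
    {η : ℝ} (hη : 0 < η) :
    ∃ N, IsOpen N ∧ x ∈ N ∧ N ∩ b.B i ⊆ g '' Set.Ioo 0 η := by
  set τ := min η δ / 2 with hτ
  have hm : 0 < min η δ := lt_min hη hδ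
  have hτ0 : 0 < τ := by linarith
  have hτη : τ < η := by linarith [min_le_left η δ]
  have hτδ : τ < δ := by linarith [min_le_right η δ]
  refine ⟨b.W ∩ b.ρ ⁻¹' Set.Iio (b.ρ (g τ)), b.continuousOn.isOpen_inter_preimage b.isOpen_W
    isOpen_Iio, ⟨b.mem_W, ?_⟩, ?_⟩
  · rw [mem_preimage, b.radius_center]
    exact b.radius_pos i _ (hB τ ⟨hτ0, hτδ⟩)
  · rintro y ⟨⟨-, hyτ⟩, hy⟩
    have hcont : ContinuousOn (b.ρ ∘ g) (Set.Icc 0 τ) :=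
      b.continuousOn.comp (hg.continuousOn.mono fun s hs => ⟨hs.1, by linarith [hs.2]⟩)
        fun s hs => hW s ⟨hs.1, by linarith [hs.2]⟩
    have hmem : b.ρ y ∈ Set.Icc ((b.ρ ∘ g) 0) ((b.ρ ∘ g) τ) := by
      refine ⟨?_, le_of_lt hyτ⟩
      rw [Function.comp_apply, hg.1, b.radius_center]
      exact (b.radius_pos i y hy).le
    obtain ⟨t, ht, hty⟩ := intermediate_value_Icc hτ0.le hcont hmem
    have ht0 : 0 < t := by
      refine lt_of_le_of_ne ht.1 fun h0 => ?_
      have := b.radius_pos i y hy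
      rw [← hty, ← h0, Function.comp_apply, hg.1, b.radius_center] at this
      exact this.false
    exact ⟨t, ⟨ht0, ht.2.trans_lt hτη⟩, b.injOn i (hB t ⟨ht0, ht.2.trans_lt hτδ⟩) hy hty⟩

/-- A unit speed path from `x` initially runs, except at `x`, in the interior of its image. -/
lemma BranchCover.exists_mem_interior {x : G} {n : ℕ} (b : BranchCover x n) {ε : ℝ} {g : ℝ → G}
    (hε : 0 < ε) (hg : IsUnitSpeedFrom x ε g) {η : ℝ} (hη : 0 < η) :
    ∃ δ > 0, ∀ t ∈ Set.Ioo 0 δ, g t ∈ interior (g '' Set.Ioo 0 η) := by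
  obtain ⟨i, δ, hδ, hδε, hW, hB⟩ := b.exists_branch hε hg
  obtain ⟨N, hN, hxN, hsub⟩ := b.exists_nhds_subset hg hδ hδε hW hB hη
  obtain ⟨δ', hδ', -, hgN⟩ := hg.exists_forall_mem hε (hN.mem_nhds hxN)
  refine ⟨min δ δ', lt_min hδ hδ', fun t ht => ?_⟩
  refine interior_maximal hsub (hN.inter (b.isOpen_B i)) ⟨hgN t ⟨ht.1.le, ?_⟩, hB t ⟨ht.1, ?_⟩⟩
  · exact ht.2.trans_le (min_le_right _ _)
  · exact ht.2.trans_le (min_le_left _ _)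

lemma BranchCover.finite_tangentDir {x : G} {n : ℕ} (b : BranchCover x n) :
    Finite (TangentDir x) := by
  have key : ∀ ζ : TangentDir x, ∃ i, ∃ ε > 0, ∃ δ, IsUnitSpeedFrom x ε (Quotient.out ζ).1 ∧
      0 < δ ∧ δ ≤ ε ∧ (∀ t ∈ Set.Ico 0 δ, (Quotient.out ζ).1 t ∈ b.W) ∧
      ∀ t ∈ Set.Ioo 0 δ, (Quotient.out ζ).1 t ∈ b.B i := fun ζ => by
    obtain ⟨ε, hε, hg⟩ := (Quotient.out ζ).2
    obtain ⟨i, δ, h⟩ := b.exists_branch hε hg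
    exact ⟨i, ε, hε, δ, hg, h⟩
  choose i ε hε δ hg hδ hδε hW hB using key
  refine Finite.of_injective i fun ζ ξ hi => ?_
  rw [← Quotient.out_eq ζ, ← Quotient.out_eq ξ]
  refine Quotient.sound ?_
  obtain ⟨N, hN, hxN, hsub⟩ :=
    b.exists_nhds_subset (hg ζ) (hδ ζ) (hδε ζ) (hW ζ) (hB ζ) (hε ζ)
  obtain ⟨δ', hδ', hδε', hgN⟩ := (hg ξ).exists_forall_mem (hε ξ) (hN.mem_nhds hxN)
  refine ⟨min δ' (δ ξ), lt_min hδ' (hδ ξ), fun t ht => ?_⟩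
  have ht₁ := ht.2.trans_le (min_le_left _ _)
  have ht₂ := ht.2.trans_le (min_le_right _ _)
  rcases ht.1.eq_or_lt with rfl | ht0
  · rw [(hg ζ).1, (hg ξ).1]
  · obtain ⟨s, hs, hst⟩ := hsub ⟨hgN t ⟨ht.1, ht₁⟩, hi ▸ hB ξ t ⟨ht0, ht₂⟩⟩
    have h₁ := (hg ζ).dist_eq ⟨hs.1.le, hs.2⟩
    rw [hst, (hg ξ).dist_eq ⟨ht.1, ht₁.trans_le hδε'⟩] at h₁
    rw [← hst, h₁]

/-! ### Firing a component of a local maximum -/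

lemma IsRational.hasSlopeAlong_tangentSlope {f : G → ℝ} (hf : IsRational f) {x : G}
    (ζ : TangentDir x) : HasSlopeAlong f (Quotient.out ζ).1 (tangentSlope f ζ) := by
  obtain ⟨ε, hε, hg⟩ := (Quotient.out ζ).2
  have h := hf.2 x ε _ hε hg
  rw [tangentSlope, dif_pos h]
  exact h.choose_spec

/-- If `f` has a local maximum at `x` and every unit speed path from `x` along which `f` is
constant stays in `C`, then the order of `f` at `x` is at most `-deg^out_C(x)`. -/
lemma ordAt_le_neg_degOut (hG : IsMetricGraph G) {f : G → ℝ} (hf : IsRational f) {x : G}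
    {C : Set G} (hmax : ∀ᶠ y in nhds x, f y ≤ f x)
    (hC : ∀ (ε : ℝ) (g : ℝ → G), 0 < ε → IsUnitSpeedFrom x ε g →
      (∀ t ∈ Set.Ico 0 ε, f (g t) = f x) → ∃ δ > 0, g '' Set.Ioo 0 δ ⊆ C) :
    ordAt f x ≤ -(degOut C x : ℤ) := by
  classical
  obtain ⟨n, U, hU, hstar⟩ := hG.2.2 x
  obtain ⟨b⟩ := hstar.exists_branchCover hU
  have := b.finite_tangentDir
  have := Fintype.ofFinite (TangentDir x)
  rw [ordAt, finsum_eq_sum_of_fintype, degOut, Nat.card_eq_fintype_card, Fintype.card_subtype,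
    Finset.card_filter, Nat.cast_sum, ← Finset.sum_neg_distrib]
  refine Finset.sum_le_sum fun ζ _ => ?_
  obtain ⟨ε, hε, hg⟩ := (Quotient.out ζ).2
  obtain ⟨δ, hδ, hs⟩ := hf.hasSlopeAlong_tangentSlope ζ
  rw [hg.1] at hs
  obtain ⟨δ', hδ', hδε', hle⟩ := hg.exists_forall_mem hε hmax
  have hnonpos : tangentSlope f ζ ≤ 0 := by
    have hm : 0 < min δ δ' := lt_min hδ hδ'
    have ht : min δ δ' / 2 ∈ Set.Ico 0 (min δ δ') := ⟨by linarith, by linarith⟩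
    have h₁ := hs _ ⟨ht.1, ht.2.trans_le (min_le_left _ _)⟩
    have h₂ := hle _ ⟨ht.1, ht.2.trans_le (min_le_right _ _)⟩
    rw [Set.mem_ofPred_eq, h₁] at h₂
    by_contra! hpos
    have : (0:ℝ) < tangentSlope f ζ := by exact_mod_cast hpos
    have := mul_pos this (half_pos hm)
    linarith
  split_ifs with hout
  · rcases hnonpos.lt_or_eq with h | h
    · push_cast
      omega
    exfalso
    have hm : 0 < min δ ε := lt_min hδ hε
    obtain ⟨η, hη, hηC⟩ := hC (min δ ε) _ hm
      ⟨hg.1, fun s hs t ht => hg.2 s ⟨hs.1, hs.2.trans_le (min_le_right _ _)⟩ t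
        ⟨ht.1, ht.2.trans_le (min_le_right _ _)⟩⟩
      (fun t ht => by
        rw [hs t ⟨ht.1, ht.2.trans_le (min_le_left _ _)⟩, h, Int.cast_zero, zero_mul, add_zero])
    obtain ⟨κ, hκ, hint⟩ := b.exists_mem_interior hε hg hη
    obtain ⟨σ, hσ, hno⟩ := hout
    have hm' : 0 < min κ σ := lt_min hκ hσ
    have ht : min κ σ / 2 ∈ Set.Ioo 0 (min κ σ) := ⟨by linarith, by linarith⟩
    exact hno _ ⟨ht.1, ht.2.trans_le (min_le_right _ _)⟩
      (interior_mono hηC (hint _ ⟨ht.1, ht.2.trans_le (min_le_left _ _)⟩))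
  · simpa using hnonpos

/-- A closed piece `B` of a superlevel set of `f ∈ R(D)`, separated from the rest `A` of the
superlevel set, contains a closed subgraph which can fire. -/
lemma exists_canFire_subset (hG : IsMetricGraph G) {D : G → ℤ} {f : G → ℝ} (hf : f ∈ RD D) {a : ℝ}
    {A B : Set G} (hA : IsClosed A) (hB : IsClosed B) (hBne : B.Nonempty) (hAB : Disjoint A B)
    (hfB : ∀ x ∈ B, a ≤ f x) (hcov : ∀ x, a ≤ f x → x ∈ A ∪ B) :
    ∃ Z ⊆ B, CanFire D Z := by
  have := hG.1
  obtain ⟨m, hmB, hm⟩ := hB.isCompact.exists_isMaxOn hBne hf.1.1.continuousOn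
  set L : Set G := B ∩ f ⁻¹' {f m} with hL
  have hLc : IsClosed L := hB.inter (isClosed_singleton.preimage hf.1.1)
  have hmL : m ∈ L := ⟨hmB, rfl⟩
  set C := connectedComponentIn L m with hCdef
  have hCL : C ⊆ L := connectedComponentIn_subset L m
  have hCpre : IsPreconnected C := isPreconnected_connectedComponentIn
  have hmC : m ∈ C := mem_connectedComponentIn hmL
  have hCc : IsClosed C := by
    have h : closure C ⊆ C := hCpre.closure.subset_connectedComponentIn (subset_closure hmC)
      (closure_minimal hCL hLc)
    exact closure_subset_iff_isClosed.mp h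
  refine ⟨C, hCL.trans inter_subset_left, ⟨m, hmC⟩, hCc, ?_, fun x hx => ?_⟩
  · refine (Set.finite_singleton C).subset ?_
    rintro _ ⟨y, hy, rfl⟩
    exact (hCpre.connectedComponentIn hy : connectedComponentIn C y = C)
  · have hxC : x ∈ C := hCc.frontier_subset hx
    have hxB : x ∈ B := (hCL hxC).1
    have hfx : f x = f m := (hCL hxC).2
    have hxA : ∀ᶠ y in nhds x, y ∈ Aᶜ :=
      hA.isOpen_compl.mem_nhds fun h => hAB.le_bot ⟨h, hxB⟩
    have hord : ordAt f x ≤ -(degOut C x : ℤ) := by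
      refine ordAt_le_neg_degOut hG hf.1 ?_ fun ε g hε hg hconst => ?_
      · filter_upwards [hxA] with y hy
        by_cases hay : a ≤ f y
        · exact hfx ▸ hm ((hcov y hay).resolve_left hy)
        · exact (not_le.mp hay).le.trans (hfB x hxB)
      · obtain ⟨δ, hδ, hδε, hgA⟩ := hg.exists_forall_mem hε hxA
        have hgL : g '' Set.Ico 0 δ ⊆ L := by
          rintro _ ⟨t, ht, rfl⟩
          have h := hconst t ⟨ht.1, ht.2.trans_le hδε⟩
          exact ⟨(hcov _ (h ▸ hfB x hxB)).resolve_left (hgA t ht), h.trans hfx⟩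
        have hgpre : IsPreconnected (g '' Set.Ico 0 δ) :=
          isPreconnected_Ico.image _ (hg.continuousOn.mono (Set.Ico_subset_Ico_right hδε))
        refine ⟨δ, hδ, (Set.image_mono Set.Ioo_subset_Ico_self).trans ?_⟩
        rw [hCdef, connectedComponentIn_eq hxC]
        exact hgpre.subset_connectedComponentIn ⟨0, ⟨le_rfl, hδ⟩, hg.1⟩ hgL
    have := hf.2 x
    omega



/-- if `D` is `v`-reduced and `f ∈ R(D)`, then for every `a ≤ f v` the
superlevel set `f⁻¹([a, ∞))` is connected. -/
theorem reduced_superlevel_connected (hG : IsMetricGraph G) (v : G) (D : G → ℤ)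
    (hD : FinSupp D) (hred : IsReduced v D) (f : G → ℝ) (hf : f ∈ RD D)
    (a : ℝ) (ha : a ≤ f v) :
    IsConnected {x | a ≤ f x} := by
  refine ⟨⟨v, ha⟩, isPreconnected_closed_iff.mpr ?_⟩
  have hS : IsClosed {x | a ≤ f x} := isClosed_le continuous_const hf.1.1
  have key : ∀ A B : Set G, IsClosed A → IsClosed B → {x | a ≤ f x} ⊆ A ∪ B → v ∈ A →
      ({x | a ≤ f x} ∩ B).Nonempty → ({x | a ≤ f x} ∩ (A ∩ B)).Nonempty := by
    intro A B hA hB hcov hvA hne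
    by_contra hemp
    obtain ⟨Z, hZ, hfire⟩ := exists_canFire_subset hG hf (hS.inter hA) (hS.inter hB) hne
      (Set.disjoint_left.mpr fun x hxA hxB => hemp ⟨x, hxA.1, hxA.2, hxB.2⟩) (fun x hx => hx.1)
      (fun x hx => (hcov hx).imp (⟨hx, ·⟩) (⟨hx, ·⟩))
    exact hred.2 Z (fun hvZ => hemp ⟨v, ha, hvA, (hZ hvZ).2⟩) hfire
  intro A B hA hB hcov hneA hneB
  rcases hcov ha with hv | hv
  · exact key A B hA hB hcov hv hneB
  · rw [Set.inter_comm A B]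
    exact key B A hB hA (Set.union_comm A B ▸ hcov) hv hneA

end TropGraph
end

section
/- Let M ⊆ ℝ^E ∪ {−∞} be a finitely generated tropical submodule and G ⊆ M a finite generating set. Then every f ∈ M satisfies f = ⊕_{g∈G} ⟨f,g⟩ ⊙ g, where ⟨f,g⟩ = inf_{x∈E}{f(x) − g(x)}. Consequently, for any tropical submodule M ⊆ ℝ^E ∪ {−∞} and finite subset G ⊆ M, an element f ∈ M lies in the submodule spanned by G if and only if f = ⊕_{g∈G} ⟨f,g⟩ ⊙ g. -/
open Set

namespace TropModule

variable {E : Type*}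

/-- Tropical scalar multiplication `c ⊙ f` on `ℝ^E ∪ {-∞}` (modelled as
`WithBot (E → ℝ)`, whose `⊔` is the tropical addition `⊕`). -/
noncomputable def tsmul (c : WithBot ℝ) (f : WithBot (E → ℝ)) : WithBot (E → ℝ) :=
  WithBot.recBotCoe ⊥ (fun c₀ => WithBot.map (fun g x => c₀ + g x) f) c

/-- A tropical submodule of `ℝ^E ∪ {-∞}`: contains `-∞`, and is closed under the
pointwise tropical addition `f ⊕ g = f ⊔ g` and tropical scaling. -/
def IsTropSubmodule (M : Set (WithBot (E → ℝ))) : Prop :=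
  ⊥ ∈ M ∧ (∀ f ∈ M, ∀ g ∈ M, f ⊔ g ∈ M) ∧ ∀ c : WithBot ℝ, ∀ f ∈ M, tsmul c f ∈ M

/-- The tropical submodule spanned by a set. -/
def tropSpan (S : Set (WithBot (E → ℝ))) : Set (WithBot (E → ℝ)) :=
  ⋂₀ {M | IsTropSubmodule M ∧ S ⊆ M}

open scoped Classical in
/-- `⟨f, g⟩ = inf_{x ∈ E} (f x - g x)`, valued in `ℝ ∪ {-∞}`. -/
noncomputable def tinner (f g : E → ℝ) : WithBot ℝ :=
  if BddBelow (Set.range fun x => f x - g x) then ((⨅ x, f x - g x : ℝ) : WithBot ℝ)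
  else ⊥

/-- The projection `⟨f, g⟩ ⊙ g` of `g` on `f` (equal to `-∞` when `f` or `g` is `-∞`). -/
noncomputable def proj (f g : WithBot (E → ℝ)) : WithBot (E → ℝ) :=
  WithBot.recBotCoe ⊥
    (fun g₀ => WithBot.recBotCoe ⊥ (fun f₀ => tsmul (tinner f₀ g₀) g) f) g

@[simp] theorem tsmul_bot_left (f : WithBot (E → ℝ)) : tsmul ⊥ f = ⊥ := rfl

@[simp] theorem tsmul_bot_right (c : WithBot ℝ) : tsmul c (⊥ : WithBot (E → ℝ)) = ⊥ := by
  cases c <;> rfl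

theorem tsmul_coe (c : ℝ) (f : E → ℝ) :
    tsmul (c : WithBot ℝ) (f : WithBot (E → ℝ)) = ((fun x => c + f x : E → ℝ)) := rfl

theorem proj_coe (f g : E → ℝ) :
    proj (f : WithBot (E → ℝ)) g = tsmul (tinner f g) g := rfl

theorem tsmul_tsmul (c d : WithBot ℝ) (f : WithBot (E → ℝ)) :
    tsmul c (tsmul d f) = tsmul (c + d) f := by
  cases c <;> cases d <;> cases f <;> try simp
  rw [← WithBot.coe_add]
  simp only [tsmul_coe, add_assoc]

theorem tsmul_mono (c : WithBot ℝ) {f g : WithBot (E → ℝ)} (h : f ≤ g) :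
    tsmul c f ≤ tsmul c g := by
  cases c <;> cases f <;> cases g <;> simp_all [tsmul_coe, Pi.le_def]

theorem tsmul_sup (c : WithBot ℝ) (f g : WithBot (E → ℝ)) :
    tsmul c (f ⊔ g) = tsmul c f ⊔ tsmul c g := by
  cases c <;> cases f <;> cases g <;> try simp
  rw [← WithBot.coe_sup]
  simp only [tsmul_coe, ← WithBot.coe_sup]
  congr 1
  funext x
  simp [max_add_add_left]

/-- The projection of `g` on `f` is a tropical multiple of `g`. -/
theorem exists_proj_eq_tsmul (f g : WithBot (E → ℝ)) : ∃ c, proj f g = tsmul c g := by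
  cases g with
  | bot => exact ⟨⊥, rfl⟩
  | coe g =>
    cases f with
    | bot => exact ⟨⊥, rfl⟩
    | coe f => exact ⟨_, proj_coe f g⟩

theorem proj_le (f g : WithBot (E → ℝ)) : proj f g ≤ f := by
  cases g with
  | bot => exact bot_le
  | coe g =>
    cases f with
    | bot => exact bot_le
    | coe f =>
      rw [proj_coe, tinner]
      split_ifs with h
      · rw [tsmul_coe, WithBot.coe_le_coe]
        intro x
        have := ciInf_le h x
        dsimp only at this ⊢
        linarith
      · exact bot_le

/-- The projection of `g` on `f` is the largest tropical multiple of `g` below `f`. -/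
theorem tsmul_le_proj [Nonempty E] {c : WithBot ℝ} {f g : WithBot (E → ℝ)}
    (h : tsmul c g ≤ f) : tsmul c g ≤ proj f g := by
  cases c with
  | bot => exact bot_le
  | coe c =>
  cases g with
  | bot => simp
  | coe g =>
  cases f with
  | bot => exact h
  | coe f =>
    rw [tsmul_coe, WithBot.coe_le_coe] at h
    have hc : ∀ x, c ≤ f x - g x := fun x => by
      have := h x
      dsimp only at this
      linarith
    have hb : BddBelow (Set.range fun x => f x - g x) := ⟨c, by rintro _ ⟨x, rfl⟩; exact hc x⟩
    rw [proj_coe, tinner, if_pos hb, tsmul_coe, tsmul_coe, WithBot.coe_le_coe]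
    intro x
    have := le_ciInf hc
    dsimp only
    linarith

theorem proj_mono [Nonempty E] {f f' : WithBot (E → ℝ)} (h : f ≤ f') (g : WithBot (E → ℝ)) :
    proj f g ≤ proj f' g := by
  have hle := (proj_le f g).trans h
  obtain ⟨c, hc⟩ := exists_proj_eq_tsmul f g
  rw [hc] at hle ⊢
  exact tsmul_le_proj hle

theorem tsmul_proj_le [Nonempty E] (c : WithBot ℝ) (f g : WithBot (E → ℝ)) :
    tsmul c (proj f g) ≤ proj (tsmul c f) g := by
  have hle := tsmul_mono c (proj_le f g)
  obtain ⟨d, hd⟩ := exists_proj_eq_tsmul f g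
  rw [hd, tsmul_tsmul] at hle ⊢
  exact tsmul_le_proj hle

theorem le_proj_self [Nonempty E] (g : WithBot (E → ℝ)) : g ≤ proj g g := by
  have h : tsmul ((0 : ℝ) : WithBot ℝ) g = g := by
    cases g with
    | bot => exact tsmul_bot_right _
    | coe g => simp only [tsmul_coe, zero_add]
  have := tsmul_le_proj h.le
  rwa [h] at this

/-- The elements recovered from their projections on a finite set form a tropical submodule. -/
theorem isTropSubmodule_le_sup_proj [Nonempty E] (G : Finset (WithBot (E → ℝ))) :
    IsTropSubmodule {f | f ≤ G.sup (proj f)} := by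
  simp only [IsTropSubmodule, Set.mem_ofPred_eq]
  refine ⟨bot_le, fun f hf g hg => sup_le ?_ ?_, fun c f hf => ?_⟩
  · exact le_trans hf (Finset.sup_mono_fun fun k _ => proj_mono le_sup_left k)
  · exact le_trans hg (Finset.sup_mono_fun fun k _ => proj_mono le_sup_right k)
  · refine (tsmul_mono c hf).trans ?_
    rw [Finset.apply_sup_eq_sup_comp (tsmul c) (tsmul_sup c) (tsmul_bot_right c)]
    exact Finset.sup_mono_fun fun k _ => tsmul_proj_le c f k

theorem mem_tropSpan_iff_eq_sup_proj [Nonempty E] (G : Finset (WithBot (E → ℝ)))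
    (f : WithBot (E → ℝ)) : f ∈ tropSpan ↑G ↔ f = G.sup (proj f) := by
  constructor
  · intro hf
    have hle : f ≤ G.sup (proj f) := hf _ ⟨isTropSubmodule_le_sup_proj G, fun g hg =>
      (le_proj_self g).trans (Finset.le_sup (f := proj g) (Finset.mem_coe.1 hg))⟩
    exact hle.antisymm (Finset.sup_le fun g _ => proj_le f g)
  · rintro hf N ⟨⟨hbot, hsup, hsmul⟩, hGN⟩
    rw [hf]
    refine Finset.sup_induction hbot hsup fun g hg => ?_
    obtain ⟨c, hc⟩ := exists_proj_eq_tsmul f g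
    rw [hc]
    exact hsmul c g (hGN hg)

/-- if `M ⊆ ℝ^E ∪ {-∞}` is a tropical submodule with finite generating set
`G`, then every `f ∈ M` satisfies `f = ⊕_{g ∈ G} ⟨f, g⟩ ⊙ g`; consequently, for any
tropical submodule `M` and finite `G ⊆ M`, an element `f ∈ M` lies in the submodule
spanned by `G` if and only if `f = ⊕_{g ∈ G} ⟨f, g⟩ ⊙ g`. -/
theorem proj_decomposition [Nonempty E]
    (M : Set (WithBot (E → ℝ))) (hM : IsTropSubmodule M)
    (Gset : Finset (WithBot (E → ℝ))) (hG : ↑Gset ⊆ M) :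
    (tropSpan ↑Gset = M → ∀ f ∈ M, f = Gset.sup (proj f)) ∧
    (∀ f ∈ M, f ∈ tropSpan ↑Gset ↔ f = Gset.sup (proj f)) := by
  exact ⟨fun h f hf => (mem_tropSpan_iff_eq_sup_proj Gset f).1 (h ▸ hf),
    fun f _ => mem_tropSpan_iff_eq_sup_proj Gset f⟩

end TropModule
end

section
/- Let Y ⊆ ℝ^n be a closed definable subset, i.e. Y is closed and can be written as a finite expression involving intersections, unions and complements of closed half-spaces H = {u ∈ ℝ^n : ⟨u,v⟩ ≥ a}. Then Y is a finite union of (possibly unbounded) convex polyhedra, where a convex polyhedron is a finite intersection of closed half-spaces. -/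
open Set

namespace PolyDef

variable {n : ℕ}

/-- The closed half-space `{u ∈ ℝ^n | ⟨u, v⟩ ≥ a}`. -/
def halfSpace (v : Fin n → ℝ) (a : ℝ) : Set (Fin n → ℝ) :=
  {u | a ≤ ∑ i, u i * v i}

/-- Definable subsets of `ℝ^n`: finite expressions in intersections, unions and
complements of closed half-spaces. -/
inductive Definable : Set (Fin n → ℝ) → Prop
  | half (v : Fin n → ℝ) (a : ℝ) : Definable (halfSpace v a)
  | inter {s t : Set (Fin n → ℝ)} : Definable s → Definable t → Definable (s ∩ t)
  | union {s t : Set (Fin n → ℝ)} : Definable s → Definable t → Definable (s ∪ t)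
  | compl {s : Set (Fin n → ℝ)} : Definable s → Definable sᶜ

/-- A (possibly unbounded) convex polyhedron: a finite intersection of closed
half-spaces. -/
def IsPolyhedron (S : Set (Fin n → ℝ)) : Prop :=
  ∃ (k : ℕ) (v : Fin k → Fin n → ℝ) (a : Fin k → ℝ), S = ⋂ i, halfSpace (v i) (a i)

/-- The half-space on the other side of the hyperplane bounding `halfSpace v a`. -/
theorem mem_halfSpace_neg {v u : Fin n → ℝ} {a : ℝ} :
    u ∈ halfSpace (-v) (-a) ↔ ∑ i, u i * v i ≤ a := by
  simp [halfSpace]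

theorem isPolyhedron_iInter {ι : Type*} [Finite ι] (v : ι → Fin n → ℝ) (a : ι → ℝ) :
    IsPolyhedron (⋂ i, halfSpace (v i) (a i)) := by
  obtain ⟨k, ⟨e⟩⟩ := Finite.exists_equiv_fin ι
  exact ⟨k, v ∘ e.symm, a ∘ e.symm,
    (e.symm.iInf_comp (g := fun i => halfSpace (v i) (a i))).symm⟩

/-- Membership in a definable set is determined by membership in finitely many half-spaces. -/
theorem Definable.exists_finite_halfSpaces {Y : Set (Fin n → ℝ)} (hY : Definable Y) :
    ∃ F : Set ((Fin n → ℝ) × ℝ), F.Finite ∧ ∀ x y : Fin n → ℝ,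
      (∀ p ∈ F, x ∈ halfSpace p.1 p.2 ↔ y ∈ halfSpace p.1 p.2) → (x ∈ Y ↔ y ∈ Y) := by
  induction hY with
  | half v a => exact ⟨{(v, a)}, finite_singleton _, fun x y h => h _ rfl⟩
  | inter _ _ ihs iht =>
    obtain ⟨F, hF, hs⟩ := ihs
    obtain ⟨G, hG, ht⟩ := iht
    exact ⟨F ∪ G, hF.union hG, fun x y h => and_congr
      (hs x y fun p hp => h p (.inl hp)) (ht x y fun p hp => h p (.inr hp))⟩
  | union _ _ ihs iht =>
    obtain ⟨F, hF, hs⟩ := ihs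
    obtain ⟨G, hG, ht⟩ := iht
    exact ⟨F ∪ G, hF.union hG, fun x y h => or_congr
      (hs x y fun p hp => h p (.inl hp)) (ht x y fun p hp => h p (.inr hp))⟩
  | compl _ ih =>
    obtain ⟨F, hF, hs⟩ := ih
    exact ⟨F, hF, fun x y h => not_congr (hs x y h)⟩

open Classical in
/-- The polyhedron cut out by the half-spaces `p ∈ F`, with those outside `s` replaced by the
closures of their complements. -/
noncomputable def patternPolyhedron (F : Set ((Fin n → ℝ) × ℝ)) (s : Set F) :
    Set (Fin n → ℝ) :=
  ⋂ p : F, halfSpace (if p ∈ s then p.1.1 else -p.1.1) (if p ∈ s then p.1.2 else -p.1.2)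

theorem mem_patternPolyhedron {F : Set ((Fin n → ℝ) × ℝ)} {s : Set F} {u : Fin n → ℝ} :
    u ∈ patternPolyhedron F s ↔
      ∀ p : F, (p ∈ s → p.1.2 ≤ ∑ i, u i * p.1.1 i) ∧
        (p ∉ s → ∑ i, u i * p.1.1 i ≤ p.1.2) := by
  rw [patternPolyhedron, mem_iInter]
  refine forall_congr' fun p => ?_
  by_cases hp : p ∈ s
  · simp [hp, halfSpace]
  · simp only [hp, if_false, mem_halfSpace_neg]
    simp

/-- The half-spaces of `F` containing `x`. -/
def pattern (F : Set ((Fin n → ℝ) × ℝ)) (x : Fin n → ℝ) : Set F :=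
  {p | x ∈ halfSpace p.1.1 p.1.2}

theorem mem_patternPolyhedron_pattern (F : Set ((Fin n → ℝ) × ℝ)) (x : Fin n → ℝ) :
    x ∈ patternPolyhedron F (pattern F x) :=
  mem_patternPolyhedron.2 fun _ => ⟨id, fun h => (not_le.1 h).le⟩

theorem pattern_lineMap {F : Set ((Fin n → ℝ) × ℝ)} {x y : Fin n → ℝ}
    (hy : y ∈ patternPolyhedron F (pattern F x)) {t : ℝ} (ht : t ∈ Ioo (0 : ℝ) 1) :
    pattern F (AffineMap.lineMap y x t) = pattern F x := by
  ext p
  have hsum : ∑ i, AffineMap.lineMap y x t i * p.1.1 i =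
      (1 - t) * ∑ i, y i * p.1.1 i + t * ∑ i, x i * p.1.1 i := by
    rw [Finset.mul_sum, Finset.mul_sum, ← Finset.sum_add_distrib]
    refine Finset.sum_congr rfl fun i _ => ?_
    simp only [AffineMap.lineMap_apply_module, Pi.add_apply, Pi.smul_apply, smul_eq_mul]
    ring
  obtain ⟨h₁, h₂⟩ := mem_patternPolyhedron.1 hy p
  have ht' : 0 < 1 - t := sub_pos.2 ht.2
  change p.1.2 ≤ _ ↔ _
  rw [hsum]
  by_cases hp : p ∈ pattern F x
  · have hx : p.1.2 ≤ ∑ i, x i * p.1.1 i := hp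
    refine iff_of_true ?_ hp
    nlinarith [mul_le_mul_of_nonneg_left (h₁ hp) ht'.le, mul_le_mul_of_nonneg_left hx ht.1.le]
  · have hx : ∑ i, x i * p.1.1 i < p.1.2 := not_le.1 hp
    refine iff_of_false (not_le.2 ?_) hp
    nlinarith [mul_le_mul_of_nonneg_left (h₂ hp) ht'.le, mul_lt_mul_of_pos_left hx ht.1]

theorem patternPolyhedron_pattern_subset_closure (F : Set ((Fin n → ℝ) × ℝ)) (x : Fin n → ℝ) :
    patternPolyhedron F (pattern F x) ⊆ closure {z | pattern F z = pattern F x} := by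
  intro y hy
  have hlim : Filter.Tendsto (fun t : ℝ => AffineMap.lineMap y x t) (nhdsWithin 0 (Ioi 0))
      (nhds y) := by
    have hcont : Continuous fun t : ℝ => (AffineMap.lineMap y x t : Fin n → ℝ) :=
      AffineMap.lineMap_continuous
    simpa using (hcont.tendsto 0).mono_left nhdsWithin_le_nhds
  refine mem_closure_of_tendsto hlim ?_
  filter_upwards [Ioo_mem_nhdsGT one_pos] with t ht using pattern_lineMap hy ht

/-- a closed definable subset of `ℝ^n` is a finite union of (possibly
unbounded) convex polyhedra. -/
theorem closed_definable_is_union_of_polyhedra {Y : Set (Fin n → ℝ)}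
    (hdef : Definable Y) (hclosed : IsClosed Y) :
    ∃ (m : ℕ) (P : Fin m → Set (Fin n → ℝ)),
      (∀ i, IsPolyhedron (P i)) ∧ Y = ⋃ i, P i := by
  obtain ⟨F, hF, hY⟩ := hdef.exists_finite_halfSpaces
  have := hF.to_subtype
  have hpat : ∀ x y, pattern F x = pattern F y → x ∈ Y → y ∈ Y := fun x y h =>
    (hY x y fun p hp => Set.ext_iff.1 h ⟨p, hp⟩).1
  obtain ⟨m, ⟨e⟩⟩ := Finite.exists_equiv_fin (pattern F '' Y)
  refine ⟨m, fun i => patternPolyhedron F (e.symm i), fun i => isPolyhedron_iInter _ _,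
    Subset.antisymm (fun x hx => ?_) (iUnion_subset fun i => ?_)⟩
  · refine mem_iUnion.2 ⟨e ⟨_, mem_image_of_mem _ hx⟩, ?_⟩
    simpa using mem_patternPolyhedron_pattern F x
  · obtain ⟨x, hx, hxi⟩ := (e.symm i).2
    rw [← hxi]
    exact (patternPolyhedron_pattern_subset_closure F x).trans
      (closure_minimal (fun z hz => hpat x z hz.symm hx) hclosed)

end PolyDef
end
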